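/- arXiv:2407.03930 — 6 statements merged into one kernel-verified Lean document; each statement's English description precedes it below -/
import Mathlib

section
/- Let n ∈ ℕ, R > 0, B ≥ 0, C ≥ 0. For each j ∈ {1, …, n} let (t_{j,k})_{k ∈ ℕ} be a sequence of real numbers with t_{j,k+1} − t_{j,k} ≥ 1/R for all k. Let b_i and w_{ij} be real numbers with |b_i| ≤ B and |w_{ij}| ≤ C for all i, j. Define, for each i and each t ∈ ℝ, the soma current μ_i(t) = b_i − ∑_{j ≠ i} w_{ij} · ∑_{k : t_{j,k} ≤ t} exp(−(t − t_{j,k})). Then |μ_i(t)| ≤ B + n·C / (1 − exp(−1/R)) for all i and all t; in particular the soma currents are bounded above and below uniformly in i and t. -/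
theorem spike_exp_sum (s : ℕ → ℝ) (q : ℝ) (h0 : 0 < q) (h1 : q < 1)
    (hs : ∀ k, Real.exp (s k) ≤ q * Real.exp (s (k + 1))) (N : ℕ) :
    ∑ k ∈ Finset.range (N + 1), Real.exp (s k) ≤ Real.exp (s N) / (1 - q) := by
  have h2 : 0 < 1 - q := by linarith
  induction N with
  | zero =>
    rw [le_div_iff₀ h2]
    simp only [zero_add, Finset.sum_range_one]
    nlinarith [Real.exp_pos (s 0)]
  | succ N ih =>
    rw [Finset.sum_range_succ]
    rw [le_div_iff₀ h2] at ih ⊢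
    nlinarith [hs N]

theorem spike_tsum (s : ℕ → ℝ) (q : ℝ) (h0 : 0 < q) (h1 : q < 1)
    (hs : ∀ k, Real.exp (s k) ≤ q * Real.exp (s (k + 1))) (τ : ℝ) :
    ∑' k : ℕ, (if s k ≤ τ then Real.exp (-(τ - s k)) else 0) ≤ 1 / (1 - q) := by
  have h2 : 0 < 1 - q := by linarith
  apply Real.tsum_le_of_sum_range_le
  · intro k
    split_ifs <;> positivity
  · intro N
    induction N with
    | zero => simp only [Finset.range_zero, Finset.sum_empty]; positivity
    | succ N ih =>
      by_cases h : s N ≤ τ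
      · calc _ ≤ ∑ k ∈ Finset.range (N + 1), Real.exp (s k) * Real.exp (-τ) := by
              apply Finset.sum_le_sum
              intro k _
              rw [← Real.exp_add]
              split_ifs
              · apply Real.exp_le_exp.2; linarith
              · positivity
          _ = (∑ k ∈ Finset.range (N + 1), Real.exp (s k)) * Real.exp (-τ) := by
              rw [Finset.sum_mul]
          _ ≤ Real.exp (s N) / (1 - q) * Real.exp (-τ) := by
              gcongr
              exact spike_exp_sum s q h0 h1 hs N
          _ = Real.exp (s N + -τ) / (1 - q) := by rw [Real.exp_add]; ring
          _ ≤ 1 / (1 - q) := by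
              gcongr
              apply Real.exp_le_one_iff.2; linarith
      · rw [Finset.sum_range_succ, if_neg h, add_zero]
        exact ih

/-- Boundedness of the soma currents (Lemma 2): if each neuron's spike times
are separated by at least `1/R`, the background inputs are bounded by `B` and
the synaptic weights by `C`, then the soma currents
`μ_i(t) = b_i − ∑_{j ≠ i} w_{ij} ∑_{k : t_{j,k} ≤ t} exp(−(t − t_{j,k}))`
satisfy `|μ_i(t)| ≤ B + n·C/(1 − exp(−1/R))` uniformly in `i` and `t`. -/
theorem soma_currents_uniformly_bounded
    (n : ℕ) (R B C : ℝ) (hR : 0 < R) (hB : 0 ≤ B) (hC : 0 ≤ C)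
    (t : Fin n → ℕ → ℝ)
    (hsep : ∀ (j : Fin n) (k : ℕ), 1 / R ≤ t j (k + 1) - t j k)
    (b : Fin n → ℝ) (w : Fin n → Fin n → ℝ)
    (hb : ∀ i, |b i| ≤ B) (hw : ∀ i j, |w i j| ≤ C)
    (μ : Fin n → ℝ → ℝ)
    (hμ : ∀ (i : Fin n) (τ : ℝ),
      μ i τ = b i - ∑ j ∈ Finset.univ.erase i,
        w i j * ∑' k : ℕ, (if t j k ≤ τ then Real.exp (-(τ - t j k)) else 0)) :
    ∀ (i : Fin n) (τ : ℝ), |μ i τ| ≤ B + n * C / (1 - Real.exp (-1 / R)) := by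
  intro i τ
  have hq1 : Real.exp (-1 / R) < 1 := by
    apply Real.exp_lt_one_iff.2
    exact div_neg_of_neg_of_pos (by norm_num) hR
  have h2 : 0 < 1 - Real.exp (-1 / R) := by linarith
  have key : ∀ j, |w i j * ∑' k : ℕ, (if t j k ≤ τ then Real.exp (-(τ - t j k)) else 0)|
      ≤ C * (1 / (1 - Real.exp (-1 / R))) := by
    intro j
    rw [abs_mul]
    apply mul_le_mul (hw i j) _ (abs_nonneg _) hC
    rw [abs_of_nonneg (tsum_nonneg fun k => by split_ifs <;> positivity)]
    apply spike_tsum (t j) _ (Real.exp_pos _) hq1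
    intro k
    rw [← Real.exp_add]
    apply Real.exp_le_exp.2
    have := hsep j k
    rw [neg_div]
    linarith
  rw [hμ]
  refine (abs_sub _ _).trans (add_le_add (hb i) ?_)
  refine (Finset.abs_sum_le_sum_abs _ _).trans ?_
  refine (Finset.sum_le_sum_of_subset_of_nonneg (Finset.erase_subset _ _)
    fun _ _ _ => abs_nonneg _).trans ?_
  refine (Finset.sum_le_sum fun j _ => key j).trans (le_of_eq ?_)
  simp only [Finset.sum_const, Finset.card_univ, Fintype.card_fin, nsmul_eq_mul]
  ring
end

section
/- Let n ∈ ℕ, t₀ ∈ ℝ, b ∈ ℝ, and w_1, …, w_n ∈ ℝ. Let σ_1, …, σ_n : ℝ → ℝ be continuous functions and let μ : ℝ → ℝ be differentiable with μ'(s) = b − μ(s) − ∑_{j=1}^n w_j·σ_j(s) for all s ≥ t₀. Define for t > t₀ the averages u(t) = (1/(t − t₀))·∫_{t₀}^{t} μ(s) ds and a_j(t) = (1/(t − t₀))·∫_{t₀}^{t} σ_j(s) ds. Then u is differentiable on (t₀, ∞) and for every t > t₀, u'(t) = b − u(t) − ∑_{j=1}^n w_j·a_j(t) − (u(t) − μ(t₀))/(t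 − t₀). -/
/-- Passing from the instantaneous soma-current dynamics
`μ' = b − μ − ∑_j w_j σ_j` to the time averages
`u(t) = (1/(t−t₀))∫_{t₀}^t μ` and `a_j(t) = (1/(t−t₀))∫_{t₀}^t σ_j` yields the
perturbed LCA dynamics
`u'(t) = b − u(t) − ∑_j w_j a_j(t) − (u(t) − μ(t₀))/(t − t₀)` for `t > t₀`. -/
theorem averaged_soma_current_dynamics
    (n : ℕ) (t₀ b : ℝ) (w : Fin n → ℝ) (σ : Fin n → ℝ → ℝ)
    (hσ : ∀ j, Continuous (σ j))
    (μ : ℝ → ℝ) (hμ : Differentiable ℝ μ)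
    (hμ' : ∀ s : ℝ, t₀ ≤ s → deriv μ s = b - μ s - ∑ j, w j * σ j s)
    (u : ℝ → ℝ) (hu : u = fun t => (1 / (t - t₀)) * ∫ s in t₀..t, μ s)
    (a : Fin n → ℝ → ℝ)
    (ha : a = fun j => fun t => (1 / (t - t₀)) * ∫ s in t₀..t, σ j s) :
    ∀ t : ℝ, t₀ < t →
      HasDerivAt u
        (b - u t - (∑ j, w j * a j t) - (u t - μ t₀) / (t - t₀)) t := by
  intro t ht
  have hne : t - t₀ ≠ 0 := (sub_pos.mpr ht).ne'
  have hc := hμ.continuous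
  have hS : Continuous (fun s => ∑ j, w j * σ j s) :=
    continuous_finsetSum _ fun j _ => continuous_const.mul (hσ j)
  have hB : Continuous (fun s => b - μ s) := continuous_const.sub hc
  have key : μ t - μ t₀ = b * (t - t₀) - (∫ s in t₀..t, μ s)
      - ∑ j, w j * ∫ s in t₀..t, σ j s := by
    have h1 : ∫ s in t₀..t, (b - μ s - ∑ j, w j * σ j s) = μ t - μ t₀ := by
      apply intervalIntegral.integral_eq_sub_of_hasDerivAt
      · intro s hs
        rw [Set.uIcc_of_le ht.le] at hs
        rw [← hμ' s hs.1]
        exact (hμ s).hasDerivAt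
      · exact ((continuous_const.sub hc).sub hS).intervalIntegrable _ _
    rw [← h1, intervalIntegral.integral_sub (hB.intervalIntegrable _ _)
      (hS.intervalIntegrable _ _), intervalIntegral.integral_sub
      (continuous_const.intervalIntegrable _ _) (hc.intervalIntegrable _ _),
      intervalIntegral.integral_finset_sum
        (fun j _ => (show Continuous (fun s => w j * σ j s) from
          continuous_const.mul (hσ j)).intervalIntegrable _ _)]
    simp only [intervalIntegral.integral_const, intervalIntegral.integral_const_mul, smul_eq_mul]
    ring
  have hI : HasDerivAt (fun t => ∫ s in t₀..t, μ s) (μ t) t := hc.integral_hasStrictDerivAt t₀ t |>.hasDerivAt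
  have hd : HasDerivAt (fun x : ℝ => x - t₀) 1 t := (hasDerivAt_id t).sub_const t₀
  have hq := hI.div hd hne
  have hsum : ∑ j, w j * a j t = (∑ j, w j * ∫ s in t₀..t, σ j s) / (t - t₀) := by
    rw [ha, Finset.sum_div]
    exact Finset.sum_congr rfl fun j _ => by ring
  have hu' : u = (fun t => ∫ s in t₀..t, μ s) / (fun x : ℝ => x - t₀) := by
    rw [hu]; funext x; simp only [Pi.div_apply]; ring
  have hut : u t = (∫ s in t₀..t, μ s) / (t - t₀) := by rw [hu']; rfl
  rw [hsum, hut, hu']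
  refine hq.congr_deriv ?_
  have e : μ t = μ t₀ + (b * (t - t₀) - (∫ s in t₀..t, μ s)
      - ∑ j, w j * ∫ s in t₀..t, σ j s) := by linarith
  rw [e]
  field_simp
  ring
end

section
/- Let A be a real M×N matrix, s ∈ ℝ^M, and λ > 0. Let T_λ : ℝ → ℝ be defined by T_λ(u) = u − λ if u > λ and T_λ(u) = 0 otherwise, applied componentwise to vectors. If u* ∈ ℝ^N satisfies the equilibrium equation u* = Aᵀs − (AᵀA − I)·T_λ(u*), then a* = T_λ(u*) is a global minimizer over {a ∈ ℝ^N : a ≥ 0 componentwise} of the constrained LASSO objective E(a) = (1/2)·‖s − A a‖₂² + λ·∑_{i=1}^N a_i. -/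
open Matrix

/-- The one-sided soft threshold `T_λ(u) = u − λ` if `u > λ`, else `0`. -/
noncomputable def softThreshPos (lam u : ℝ) : ℝ := if lam < u then u - lam else 0

/-- The constrained LASSO objective
`E(a) = (1/2)·‖s − A a‖₂² + λ·∑ᵢ aᵢ`. -/
noncomputable def constrainedLassoObj {M N : ℕ} (A : Matrix (Fin M) (Fin N) ℝ)
    (s : Fin M → ℝ) (lam : ℝ) (a : Fin N → ℝ) : ℝ :=
  (1 / 2) * ∑ i, (s i - A.mulVec a i) ^ 2 + lam * ∑ i, a i

/-- If `u*` is an equilibrium of the LCA dynamics, i.e.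
`u* = Aᵀs − (AᵀA − I)·T_λ(u*)`, then `a* = T_λ(u*)` is a global minimizer
of the constrained LASSO objective over the nonnegative orthant. -/
theorem lca_equilibrium_solves_constrained_lasso
    {M N : ℕ} (A : Matrix (Fin M) (Fin N) ℝ) (s : Fin M → ℝ)
    (lam : ℝ) (hlam : 0 < lam) (ustar : Fin N → ℝ)
    (heq : ustar =
      Aᵀ.mulVec s - (Aᵀ * A - 1).mulVec (fun i => softThreshPos lam (ustar i))) :
    ∀ a : Fin N → ℝ, (∀ i, 0 ≤ a i) →
      constrainedLassoObj A s lam (fun i => softThreshPos lam (ustar i)) ≤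
        constrainedLassoObj A s lam a := by
  intro a ha
  set T : Fin N → ℝ := fun i => softThreshPos lam (ustar i) with hT
  have hg : Aᵀ.mulVec (s - A.mulVec T) = ustar - T := by
    rw [Matrix.sub_mulVec, Matrix.one_mulVec, ← Matrix.mulVec_mulVec] at heq
    rw [Matrix.mulVec_sub]
    funext i
    have h := congrFun heq i
    simp only [Pi.sub_apply] at h ⊢
    linarith
  have hin : ∑ i, (s i - A.mulVec T i) * (A.mulVec a i - A.mulVec T i)
      = ∑ j, (ustar j - T j) * (a j - T j) := by
    have h : (s - A.mulVec T) ⬝ᵥ A.mulVec (a - T) = (ustar - T) ⬝ᵥ (a - T) := by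
      rw [Matrix.dotProduct_mulVec, ← Matrix.mulVec_transpose, hg]
    rw [Matrix.mulVec_sub] at h
    simpa only [dotProduct, Pi.sub_apply] using h
  have hpt : ∑ j, (ustar j - T j) * (a j - T j) ≤ ∑ j, lam * (a j - T j) := by
    apply Finset.sum_le_sum
    intro j _
    have hj := ha j
    simp only [hT, softThreshPos]
    split_ifs with h
    · apply le_of_eq; ring
    · push Not at h
      nlinarith
  have hsq : ∑ i, (s i - A.mulVec T i) ^ 2 - 2 * ∑ i, (s i - A.mulVec T i) * (A.mulVec a i - A.mulVec T i)
      ≤ ∑ i, (s i - A.mulVec a i) ^ 2 := by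
    rw [Finset.mul_sum, ← Finset.sum_sub_distrib]
    apply Finset.sum_le_sum
    intro i _
    nlinarith [sq_nonneg (A.mulVec a i - A.mulVec T i)]
  rw [← Finset.mul_sum, Finset.sum_sub_distrib] at hpt
  unfold constrainedLassoObj
  linarith
end

section
/- Let A be a real M×N matrix, s ∈ ℝ^M, and λ > 0. Let T_λ : ℝ → ℝ be defined by T_λ(u) = u − λ if u > λ and T_λ(u) = 0 otherwise, applied componentwise to vectors. If a* ∈ ℝ^N with a* ≥ 0 componentwise is a global minimizer over {a ∈ ℝ^N : a ≥ 0} of E(a) = (1/2)·‖s − A a‖₂² + λ·∑_{i=1}^N a_i, then u* = a* + Aᵀ(s − A a*) satisfies T_λ(u*) = a* and the equilibrium equation u* = Aᵀs − (AᵀA − I)·T_λ(u*). -/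
open Matrix

theorem lasso_perturb_aux {M N : ℕ} (A : Matrix (Fin M) (Fin N) ℝ)
    (s : Fin M → ℝ) (lam : ℝ) (a : Fin N → ℝ) (j : Fin N) (t : ℝ) :
    constrainedLassoObj A s lam (a + Pi.single j t) = constrainedLassoObj A s lam a
      + t * (lam - Aᵀ.mulVec (s - A.mulVec a) j) + t ^ 2 / 2 * ∑ i, A i j ^ 2 := by
  have h1 : ∀ i, A.mulVec (a + Pi.single j t) i = A.mulVec a i + A i j * t := by
    intro i
    rw [Matrix.mulVec_add, Pi.add_apply]
    simp [Matrix.mulVec, dotProduct, Pi.single_apply]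
  have h2 : ∑ i, (a + Pi.single j t : Fin N → ℝ) i = ∑ i, a i + t := by
    simp [Finset.sum_add_distrib]
  have h3 : Aᵀ.mulVec (s - A.mulVec a) j = ∑ i, A i j * (s i - A.mulVec a i) := by
    rfl
  have h4 : ∑ i, (s i - A.mulVec (a + Pi.single j t) i) ^ 2
      = ∑ i, (s i - A.mulVec a i) ^ 2 - 2 * t * ∑ i, A i j * (s i - A.mulVec a i)
        + t ^ 2 * ∑ i, A i j ^ 2 := by
    rw [Finset.mul_sum, Finset.mul_sum, ← Finset.sum_sub_distrib, ← Finset.sum_add_distrib]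
    refine Finset.sum_congr rfl fun i _ => ?_
    rw [h1]; ring
  unfold constrainedLassoObj
  rw [h2, h3, h4]; ring

/-- If `a* ≥ 0` is a global minimizer of the constrained LASSO objective over
the nonnegative orthant, then `u* = a* + Aᵀ(s − A a*)` satisfies
`T_λ(u*) = a*` and the LCA equilibrium equation
`u* = Aᵀs − (AᵀA − I)·T_λ(u*)`. -/
theorem constrained_lasso_minimizer_gives_lca_equilibrium
    {M N : ℕ} (A : Matrix (Fin M) (Fin N) ℝ) (s : Fin M → ℝ)
    (lam : ℝ) (hlam : 0 < lam) (astar : Fin N → ℝ)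
    (hpos : ∀ i, 0 ≤ astar i)
    (hmin : ∀ a : Fin N → ℝ, (∀ i, 0 ≤ a i) →
      constrainedLassoObj A s lam astar ≤ constrainedLassoObj A s lam a)
    (ustar : Fin N → ℝ)
    (hu : ustar = astar + Aᵀ.mulVec (s - A.mulVec astar)) :
    (fun i => softThreshPos lam (ustar i)) = astar ∧
    ustar =
      Aᵀ.mulVec s - (Aᵀ * A - 1).mulVec (fun i => softThreshPos lam (ustar i)) := by
  have key : ∀ j t, 0 ≤ astar j + t →
      0 ≤ t * (lam - Aᵀ.mulVec (s - A.mulVec astar) j) + t ^ 2 / 2 * ∑ i, A i j ^ 2 := by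
    intro j t ht
    have h := hmin (astar + Pi.single j t) (by
      intro i
      by_cases hij : i = j
      · subst hij; simpa using ht
      · simpa [hij] using hpos i)
    rw [lasso_perturb_aux] at h
    linarith
  have hT : (fun i => softThreshPos lam (ustar i)) = astar := by
    funext j
    have hk := key j
    have hu' : ustar j = astar j + Aᵀ.mulVec (s - A.mulVec astar) j := by rw [hu]; rfl
    have hQ : 0 ≤ ∑ i, A i j ^ 2 := Finset.sum_nonneg fun i _ => sq_nonneg _
    have hp := hpos j
    generalize Aᵀ.mulVec (s - A.mulVec astar) j = g at hk hu'
    generalize (∑ i, A i j ^ 2) = Q at hk hQ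
    have hq : 0 < Q + 1 := by linarith
    have hc : g ≤ lam := by
      by_contra! hlt
      have ht : 0 < (g - lam) / (Q + 1) := div_pos (by linarith) hq
      have h := hk ((g - lam) / (Q + 1)) (by linarith)
      have e : (g - lam) / (Q + 1) * (Q + 1) = g - lam := div_mul_cancel₀ _ hq.ne'
      generalize (g - lam) / (Q + 1) = t at ht h e
      have e2 : lam - g = -(t * (Q + 1)) := by linarith
      rw [e2] at h
      nlinarith [mul_pos ht ht, mul_nonneg (mul_pos ht ht).le hQ]
    unfold softThreshPos
    rw [hu']
    rcases hp.eq_or_lt with h0 | h0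
    · rw [← h0, if_neg (by linarith)]
    · have hg : lam ≤ g := by
        by_contra! hlt
        have ht : 0 < min (astar j) ((lam - g) / (Q + 1)) :=
          lt_min h0 (div_pos (by linarith) hq)
        have hl := min_le_left (astar j) ((lam - g) / (Q + 1))
        have hr := min_le_right (astar j) ((lam - g) / (Q + 1))
        rw [le_div_iff₀ hq] at hr
        generalize min (astar j) ((lam - g) / (Q + 1)) = t at ht hl hr
        have h := hk (-t) (by linarith)
        nlinarith [mul_pos ht ht, mul_nonneg (mul_pos ht ht).le hQ,
          mul_le_mul_of_nonneg_left hr ht.le]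
      have : g = lam := le_antisymm hc hg
      rw [if_pos (by linarith)]; linarith
  refine ⟨hT, ?_⟩
  rw [hT, hu, Matrix.mulVec_sub, Matrix.sub_mulVec, Matrix.one_mulVec, Matrix.mulVec_mulVec]
  abel
end

section
/- Let A be a real M×N matrix, s ∈ ℝ^M, and λ > 0. Let T_{±λ} : ℝ → ℝ be defined by T_{±λ}(u) = sign(u)·max(|u| − λ, 0), applied componentwise to vectors. If u* ∈ ℝ^N satisfies the equilibrium equation u* = Aᵀs − (AᵀA − I)·T_{±λ}(u*), then a* = T_{±λ}(u*) is a global minimizer over ℝ^N of the LASSO objective E(a) = (1/2)·‖s − A a‖₂² + λ·‖a‖₁. -/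
open Matrix

/-- The two-sided soft threshold `T_{±λ}(u) = sign(u)·max(|u| − λ, 0)`. -/
noncomputable def softThresh (lam u : ℝ) : ℝ := Real.sign u * max (|u| - lam) 0

/-- The (unconstrained) LASSO objective
`E(a) = (1/2)·‖s − A a‖₂² + λ·‖a‖₁`. -/
noncomputable def lassoObj {M N : ℕ} (A : Matrix (Fin M) (Fin N) ℝ)
    (s : Fin M → ℝ) (lam : ℝ) (a : Fin N → ℝ) : ℝ :=
  (1 / 2) * ∑ i, (s i - A.mulVec a i) ^ 2 + lam * ∑ i, |a i|

theorem softThresh_aux (lam u b : ℝ) (hlam : 0 < lam) :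
    (u - softThresh lam u) * (b - softThresh lam u) ≤ lam * |b| - lam * |softThresh lam u| := by
  have h1 := le_abs_self b
  have h2 := neg_abs_le b
  unfold softThresh
  rcases lt_trichotomy u 0 with h | h | h
  · rw [Real.sign_of_neg h, abs_of_neg h]
    rcases le_total (-u - lam) 0 with h3 | h3
    · rw [max_eq_right h3]
      simp
      nlinarith
    · rw [max_eq_left h3, abs_of_nonpos (by linarith : -1 * (-u - lam) ≤ 0)]
      nlinarith
  · subst h
    simp
    positivity
  · rw [Real.sign_of_pos h, abs_of_pos h]
    rcases le_total (u - lam) 0 with h3 | h3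
    · rw [max_eq_right h3]
      simp
      nlinarith
    · rw [max_eq_left h3, abs_of_nonneg (by linarith : 0 ≤ 1 * (u - lam))]
      nlinarith

/-- If `u*` is an equilibrium of the LCA dynamics with the two-sided soft
threshold, i.e. `u* = Aᵀs − (AᵀA − I)·T_{±λ}(u*)`, then `a* = T_{±λ}(u*)` is a
global minimizer of the LASSO objective over `ℝ^N`. -/
theorem lca_equilibrium_solves_lasso
    {M N : ℕ} (A : Matrix (Fin M) (Fin N) ℝ) (s : Fin M → ℝ)
    (lam : ℝ) (hlam : 0 < lam) (ustar : Fin N → ℝ)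
    (heq : ustar =
      Aᵀ.mulVec s - (Aᵀ * A - 1).mulVec (fun i => softThresh lam (ustar i))) :
    ∀ a : Fin N → ℝ,
      lassoObj A s lam (fun i => softThresh lam (ustar i)) ≤ lassoObj A s lam a := by
  intro b
  set t : Fin N → ℝ := fun i => softThresh lam (ustar i) with ht
  have hr : ustar - t = Aᵀ.mulVec (s - A.mulVec t) := by
    rw [Matrix.sub_mulVec, Matrix.one_mulVec, ← Matrix.mulVec_mulVec] at heq
    rw [Matrix.mulVec_sub]
    nth_rewrite 1 [heq]
    abel
  have hdot : (ustar - t) ⬝ᵥ (b - t) = (s - A.mulVec t) ⬝ᵥ (A.mulVec b - A.mulVec t) := by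
    rw [hr, Matrix.mulVec_transpose, ← Matrix.dotProduct_mulVec, Matrix.mulVec_sub]
  have hle : (ustar - t) ⬝ᵥ (b - t) ≤ lam * ∑ i, |b i| - lam * ∑ i, |t i| := by
    rw [Finset.mul_sum, Finset.mul_sum, ← Finset.sum_sub_distrib]
    exact Finset.sum_le_sum fun i _ => softThresh_aux lam (ustar i) (b i) hlam
  have hq : (1 / 2) * ∑ i, (s i - A.mulVec t i) ^ 2
      - (s - A.mulVec t) ⬝ᵥ (A.mulVec b - A.mulVec t)
      ≤ (1 / 2) * ∑ i, (s i - A.mulVec b i) ^ 2 := by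
    rw [Finset.mul_sum, Finset.mul_sum, dotProduct, ← Finset.sum_sub_distrib]
    refine Finset.sum_le_sum fun i _ => ?_
    simp only [Pi.sub_apply]
    nlinarith [sq_nonneg (A.mulVec b i - A.mulVec t i)]
  unfold lassoObj
  linarith
end

section
/- Let η > 0 and λ > 0 with 3·√3·λ ≤ 8·η². For the arctangent penalty C̃(x) = arctan(x/η): C̃ is nonnegative on [0, ∞), its derivative C̃′(x) = η/(η² + x²) is continuous and positive on [0, ∞), and the function T_λ⁻¹(x) = x + λ·η/(η² + x²) is strictly monotonically increasing on (0, ∞). -/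
/-- The arctangent penalty `C̃(x) = arctan(x/η)` with `η > 0` and
`3√3·λ ≤ 8η²`: `C̃` is nonnegative on `[0, ∞)`, its derivative is
`C̃′(x) = η/(η² + x²)`, which is continuous and positive on `[0, ∞)`, and
`T_λ⁻¹(x) = x + λ·η/(η² + x²)` is strictly increasing on `(0, ∞)`. -/
theorem arctan_penalty_rules
    (η lam : ℝ) (hη : 0 < η) (hlam : 0 < lam)
    (hcond : 3 * Real.sqrt 3 * lam ≤ 8 * η ^ 2) :
    (∀ x ∈ Set.Ici (0 : ℝ), 0 ≤ Real.arctan (x / η)) ∧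
    (∀ x ∈ Set.Ici (0 : ℝ),
      HasDerivAt (fun y => Real.arctan (y / η)) (η / (η ^ 2 + x ^ 2)) x) ∧
    ContinuousOn (fun x => η / (η ^ 2 + x ^ 2)) (Set.Ici 0) ∧
    (∀ x ∈ Set.Ici (0 : ℝ), 0 < η / (η ^ 2 + x ^ 2)) ∧
    StrictMonoOn (fun x => x + lam * η / (η ^ 2 + x ^ 2)) (Set.Ioi 0) := by
  have hpos : ∀ x : ℝ, 0 < η ^ 2 + x ^ 2 := fun x => by positivity
  refine ⟨?_, ?_, ?_, ?_, ?_⟩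
  · intro x hx
    exact Real.arctan_nonneg.mpr (div_nonneg hx hη.le)
  · intro x _
    have h : HasDerivAt (fun y => Real.arctan (y / η)) (1 / (1 + (x / η) ^ 2) * (1 / η)) x :=
      ((hasDerivAt_id x).div_const η).arctan
    have hx := (hpos x).ne'
    convert h using 1
    have h2 : 1 + (x / η) ^ 2 = (η ^ 2 + x ^ 2) / η ^ 2 := by field_simp
    rw [h2]
    field_simp
  · exact ContinuousOn.div (by fun_prop) (by fun_prop) (fun x _ => (hpos x).ne')
  · intro x _
    exact div_pos hη (hpos x)
  · intro x hx y hy hxy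
    have hx : 0 < x := hx
    have hy : 0 < y := hy
    have hr : Real.sqrt 3 ^ 2 = 3 := Real.sq_sqrt (by norm_num)
    have hr0 : 0 < Real.sqrt 3 := by positivity
    generalize Real.sqrt 3 = r at *
    have hl : 9 * lam ≤ 8 * r * η ^ 2 := by
      have := mul_le_mul_of_nonneg_left hcond hr0.le
      nlinarith
    have hr2 : r < 9 / 4 := by nlinarith
    have key : lam * η * (x + y) < (η ^ 2 + x ^ 2) * (η ^ 2 + y ^ 2) := by
      have e : (η ^ 2 + x ^ 2) * (η ^ 2 + y ^ 2)
          = (η ^ 2 - x * y) ^ 2 + η ^ 2 * (x + y) ^ 2 := by ring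
      rw [e]
      have hes : 0 < η * (x + y) := by positivity
      have h1 : 9 * (lam * η * (x + y)) ≤ 8 * r * η ^ 2 * (η * (x + y)) := by
        have := mul_le_mul_of_nonneg_right hl hes.le
        linarith
      rcases le_or_gt (2 * η) (x + y) with hs | hs
      · have h2 : lam < 2 * η ^ 2 := by
          have : r * η ^ 2 < 9 / 4 * η ^ 2 := mul_lt_mul_of_pos_right hr2 (by positivity)
          linarith
        have h3 : lam * (η * (x + y)) < 2 * η ^ 2 * (η * (x + y)) :=
          mul_lt_mul_of_pos_right h2 hes
        have h4 : (η ^ 2 * (x + y)) * (2 * η) ≤ (η ^ 2 * (x + y)) * (x + y) :=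
          mul_le_mul_of_nonneg_left hs (by positivity)
        nlinarith [sq_nonneg (η ^ 2 - x * y)]
      · obtain ⟨t, ht⟩ : ∃ t, t = (x + y) / 2 := ⟨_, rfl⟩
        have hxy' : x + y = 2 * t := by linarith
        have ht0 : 0 < t := by linarith
        have htη : t < η := by linarith
        have hp : x * y < t ^ 2 := by
          rw [ht]; nlinarith [mul_pos (sub_pos.2 hxy) (sub_pos.2 hxy)]
        have hq : t ^ 2 < η ^ 2 := by nlinarith
        have h5 : (η ^ 2 - t ^ 2) ^ 2 < (η ^ 2 - x * y) ^ 2 :=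
          pow_lt_pow_left₀ (by linarith) (by linarith) (by norm_num)
        rw [hxy'] at h1 ⊢
        have h6 : 0 ≤ (r * t - η) ^ 2 * ((r * t) ^ 2 + 2 * (r * t) * η + 9 * η ^ 2) := by
          positivity
        have h7 : (r * t - η) ^ 2 * ((r * t) ^ 2 + 2 * (r * t) * η + 9 * η ^ 2)
            = (r ^ 2 * t ^ 2 + 3 * η ^ 2) ^ 2 - 16 * η ^ 3 * (r * t) := by ring
        rw [h7, hr] at h6
        nlinarith
    have hX := hpos x
    have hY := hpos y
    have e2 : (y + lam * η / (η ^ 2 + y ^ 2)) - (x + lam * η / (η ^ 2 + x ^ 2))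
        = (y - x) * ((η ^ 2 + x ^ 2) * (η ^ 2 + y ^ 2) - lam * η * (x + y))
          / ((η ^ 2 + x ^ 2) * (η ^ 2 + y ^ 2)) := by
      field_simp
      ring
    have h8 := div_pos (mul_pos (sub_pos.2 hxy) (sub_pos.2 key)) (mul_pos hX hY)
    rw [← e2] at h8
    exact sub_pos.1 h8
end
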